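/- Let $f : \mathbb{X} \to \mathbb{R}^d$ have global $L_2$ sensitivity $\Delta > 0$, with the supremum $\Delta = \sup_{x \simeq x'}\|f(x)-f(x')\|_2$ attained. For any $\varepsilon \geq 0$ and $\delta \in [0,1]$, the Gaussian mechanism $M(x) = f(x) + \mathcal{N}(0, \sigma^2 I_d)$ is $(\varepsilon, \delta)$-DP if and only if $\Phi\left(\frac{\Delta}{2\sigma} - \frac{\varepsilon\sigma}{\Delta}\right) - e^{\varepsilon}\Phi\left(-\frac{\Delta}{2\sigma} - \frac{\varepsilon\sigma}{\Delta}\right) \leq \delta$. -/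

import Mathlib

open MeasureTheory

/-- The standard Gaussian cumulative distribution function. -/
noncomputable def Phi (t : ℝ) : ℝ :=
  ∫ y in Set.Iic t, Real.exp (-y ^ 2 / 2) / Real.sqrt (2 * Real.pi)

/-- Density of the multivariate Gaussian `N(μ, σ² I_d)` on `ℝ^d`. -/
noncomputable def gpdf (d : ℕ) (σ : ℝ) (μ y : EuclideanSpace ℝ (Fin d)) : ℝ :=
  (2 * Real.pi * σ ^ 2) ^ (-(d : ℝ) / 2) * Real.exp (-‖y - μ‖ ^ 2 / (2 * σ ^ 2))

open ProbabilityTheory in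
lemma gaussianReal_Iic_eq_Phi (t : ℝ) : (gaussianReal 0 1).real (Set.Iic t) = Phi t := by
  rw [measureReal_def, gaussianReal_apply_eq_integral _ one_ne_zero, ENNReal.toReal_ofReal
    (integral_nonneg fun x => gaussianPDFReal_nonneg _ _ _), Phi]
  congr 1
  ext y
  simp [gaussianPDFReal, div_eq_inv_mul]

open ProbabilityTheory in
lemma gaussianReal_Ici_eq_Phi (m c : ℝ) {σ : ℝ} (hσ : 0 < σ) :
    (gaussianReal m (σ ^ 2).toNNReal).real (Set.Ici c) = Phi ((m - c) / σ) := by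
  have h : gaussianReal m (σ ^ 2).toNNReal = (gaussianReal 0 1).map fun x => m - σ * x := by
    have : (fun x : ℝ => m - σ * x) = (fun x => m - x) ∘ fun x => σ * x := rfl
    rw [this, ← Measure.map_map (by fun_prop) (by fun_prop), gaussianReal_map_const_mul,
      gaussianReal_map_const_sub]
    congr 1
    · simp
    · ext
      simp [sq_nonneg]
  rw [h, map_measureReal_apply (by fun_prop) measurableSet_Ici, ← gaussianReal_Iic_eq_Phi]
  congr 1
  ext x
  simp only [Set.mem_preimage, Set.mem_Ici, Set.mem_Iic, le_div_iff₀ hσ]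
  constructor <;> intro h <;> linarith

lemma hasDerivAt_Phi (t : ℝ) :
    HasDerivAt Phi (Real.exp (-t ^ 2 / 2) / Real.sqrt (2 * Real.pi)) t := by
  have hi : Integrable fun y : ℝ => Real.exp (-y ^ 2 / 2) / Real.sqrt (2 * Real.pi) := by
    refine Integrable.div_const ?_ _
    convert integrable_exp_neg_mul_sq (b := 1 / 2) (by norm_num) using 3
    ring
  have hc : Continuous fun y : ℝ => Real.exp (-y ^ 2 / 2) / Real.sqrt (2 * Real.pi) := by
    fun_prop
  have hP : Phi = fun u => (∫ y in (0 : ℝ)..u, Real.exp (-y ^ 2 / 2) / Real.sqrt (2 * Real.pi))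
      + Phi 0 := by
    ext u
    rw [← intervalIntegral.integral_Iic_sub_Iic hi.integrableOn hi.integrableOn]
    simp [Phi]
  rw [hP]
  exact (intervalIntegral.integral_hasDerivAt_right (hc.intervalIntegrable _ _)
    (hc.stronglyMeasurableAtFilter _ _) hc.continuousAt).add_const _

/-- The hockey-stick divergence between two unit-variance Gaussians, as a function of the distance
between their means, is monotone. -/
lemma monotoneOn_Phi_sub (ε : ℝ) :
    MonotoneOn (fun r => Phi (r / 2 - ε / r) - Real.exp ε * Phi (-(r / 2) - ε / r))
      (Set.Ioi 0) := by
  have hd : ∀ r ∈ Set.Ioi (0 : ℝ),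
      HasDerivAt (fun r => Phi (r / 2 - ε / r) - Real.exp ε * Phi (-(r / 2) - ε / r))
        (Real.exp (-(r / 2 - ε / r) ^ 2 / 2) / Real.sqrt (2 * Real.pi)) r := by
    intro r hr
    have hr0 : r ≠ 0 := ne_of_gt hr
    have h2 : HasDerivAt (fun r : ℝ => r / 2) (1 / 2) r := (hasDerivAt_id r).div_const 2
    have h3 : HasDerivAt (fun r : ℝ => ε / r) (-ε / r ^ 2) r := by
      simpa [div_eq_mul_inv] using (hasDerivAt_inv hr0).const_mul ε
    have h := ((hasDerivAt_Phi _).comp r (h2.sub h3)).sub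
      (((hasDerivAt_Phi _).comp r (h2.neg.sub h3)).const_mul (Real.exp ε))
    refine HasDerivAt.congr_deriv h ?_
    have he : Real.exp (-(r / 2 - ε / r) ^ 2 / 2)
        = Real.exp ε * Real.exp (-(-(r / 2) - ε / r) ^ 2 / 2) := by
      rw [← Real.exp_add]
      congr 1
      field_simp
      ring
    simp only [Pi.sub_apply, Pi.neg_apply]
    rw [he]
    ring
  refine monotoneOn_of_deriv_nonneg (convex_Ioi 0)
    (fun r hr => (hd r hr).continuousAt.continuousWithinAt)
    (fun r hr => (hd r (interior_subset hr)).differentiableAt.differentiableWithinAt) fun r hr => ?_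
  rw [(hd r (interior_subset hr)).deriv]
  positivity

lemma continuous_gpdf (d : ℕ) (σ : ℝ) (a : EuclideanSpace ℝ (Fin d)) :
    Continuous (gpdf d σ a) := by
  unfold gpdf
  fun_prop

lemma gpdf_nonneg (d : ℕ) (σ : ℝ) (a y : EuclideanSpace ℝ (Fin d)) : 0 ≤ gpdf d σ a y := by
  unfold gpdf
  positivity

lemma integrable_gpdf {d : ℕ} {σ : ℝ} (hσ : 0 < σ) (a : EuclideanSpace ℝ (Fin d)) :
    Integrable (gpdf d σ a) := by
  have hb : 0 < (((1 / (2 * σ ^ 2) : ℝ) : ℂ)).re := by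
    rw [Complex.ofReal_re]; positivity
  have h := (GaussianFourier.integrable_cexp_neg_mul_sq_norm_add hb 0
    (0 : EuclideanSpace ℝ (Fin d))).re
  have h' : Integrable fun v : EuclideanSpace ℝ (Fin d) => Real.exp (-‖v‖ ^ 2 / (2 * σ ^ 2)) := by
    refine h.congr (ae_of_all _ fun v => ?_)
    have : -(((1 / (2 * σ ^ 2) : ℝ) : ℂ)) * (‖v‖ : ℂ) ^ 2 +
        0 * ((inner ℝ (0 : EuclideanSpace ℝ (Fin d)) v : ℝ) : ℂ)
        = ((-‖v‖ ^ 2 / (2 * σ ^ 2) : ℝ) : ℂ) := by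
      push_cast
      ring
    simp only [this]
    exact Complex.exp_ofReal_re _
  exact (h'.comp_sub_right a).const_mul _

lemma isFiniteMeasure_withDensity_gpdf {d : ℕ} {σ : ℝ} (hσ : 0 < σ)
    (a : EuclideanSpace ℝ (Fin d)) :
    IsFiniteMeasure (volume.withDensity fun y => ENNReal.ofReal (gpdf d σ a y)) :=
  isFiniteMeasure_withDensity_ofReal (integrable_gpdf hσ a).2

lemma toReal_withDensity_gpdf {d : ℕ} (σ : ℝ) (a : EuclideanSpace ℝ (Fin d))
    {E : Set (EuclideanSpace ℝ (Fin d))} (hE : MeasurableSet E) :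
    ((volume.withDensity fun y => ENNReal.ofReal (gpdf d σ a y)) E).toReal
      = ∫ y in E, gpdf d σ a y := by
  rw [withDensity_apply _ hE, integral_eq_lintegral_of_nonneg_ae
    (ae_of_all _ (gpdf_nonneg d σ a)) (continuous_gpdf d σ a).aestronglyMeasurable]

lemma charFun_withDensity_gpdf {d : ℕ} {σ : ℝ} (hσ : 0 < σ) (a t : EuclideanSpace ℝ (Fin d)) :
    charFun (volume.withDensity fun y => ENNReal.ofReal (gpdf d σ a y)) t
      = Complex.exp (inner ℝ a t * Complex.I - σ ^ 2 * ‖t‖ ^ 2 / 2) := by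
  have hσc : (σ : ℂ) ≠ 0 := by exact_mod_cast hσ.ne'
  have hb : 0 < (((1 / (2 * σ ^ 2) : ℝ) : ℂ)).re := by
    rw [Complex.ofReal_re]; positivity
  have hK : (((2 * Real.pi * σ ^ 2) ^ (-(d : ℝ) / 2) : ℝ) : ℂ) *
      (Real.pi / ((1 / (2 * σ ^ 2) : ℝ) : ℂ)) ^
        (Module.finrank ℝ (EuclideanSpace ℝ (Fin d)) / 2 : ℂ) = 1 := by
    have h1 : ((Real.pi : ℂ) / ((1 / (2 * σ ^ 2) : ℝ) : ℂ))
        = ((2 * Real.pi * σ ^ 2 : ℝ) : ℂ) := by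
      push_cast
      field_simp
    have h2 : (Module.finrank ℝ (EuclideanSpace ℝ (Fin d)) / 2 : ℂ) = (((d : ℝ) / 2 : ℝ) : ℂ) := by
      simp
    rw [h1, h2, ← Complex.ofReal_cpow (by positivity), ← Complex.ofReal_mul,
      ← Real.rpow_add (by positivity)]
    simp [neg_div]
  rw [charFun_apply, integral_withDensity_eq_integral_toReal_smul
    (continuous_gpdf d σ a).measurable.ennreal_ofReal (ae_of_all _ fun _ => ENNReal.ofReal_lt_top),
    ← integral_add_right_eq_self _ a]
  have hI : ∀ y : EuclideanSpace ℝ (Fin d), (ENNReal.ofReal (gpdf d σ a (y + a))).toReal •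
      Complex.exp (((inner ℝ (y + a) t : ℝ) : ℂ) * Complex.I) =
      ((((2 * Real.pi * σ ^ 2) ^ (-(d : ℝ) / 2) : ℝ) : ℂ) *
        Complex.exp (inner ℝ a t * Complex.I)) *
      Complex.exp (-((1 / (2 * σ ^ 2) : ℝ) : ℂ) * ‖y‖ ^ 2 + Complex.I * (inner ℝ t y : ℝ)) := by
    intro y
    rw [ENNReal.toReal_ofReal (gpdf_nonneg d σ a _), gpdf, add_sub_cancel_right, Complex.real_smul,
      inner_add_left, real_inner_comm t y, Complex.ofReal_mul, Complex.ofReal_exp,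
      mul_assoc (Complex.ofReal _), mul_assoc (Complex.ofReal _), ← Complex.exp_add,
      ← Complex.exp_add]
    congr 2
    push_cast
    ring
  simp_rw [hI]
  rw [integral_const_mul, GaussianFourier.integral_cexp_neg_mul_sq_norm_add hb, mul_mul_mul_comm,
    hK, one_mul, ← Complex.exp_add]
  congr 1
  rw [Complex.I_sq]
  push_cast
  field_simp
  ring

open ProbabilityTheory in
lemma map_inner_withDensity_gpdf {d : ℕ} {σ : ℝ} (hσ : 0 < σ) (a : EuclideanSpace ℝ (Fin d))
    {u : EuclideanSpace ℝ (Fin d)} (hu : ‖u‖ = 1) :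
    (volume.withDensity fun y => ENNReal.ofReal (gpdf d σ a y)).map (fun y => inner ℝ y u)
      = gaussianReal (inner ℝ a u) (σ ^ 2).toNNReal := by
  have := isFiniteMeasure_withDensity_gpdf hσ a
  refine Measure.ext_of_charFun (funext fun t => ?_)
  have h := charFun_withDensity_gpdf hσ a (t • u)
  rw [charFun_apply] at h
  rw [charFun_gaussianReal, charFun_apply_real, integral_map (by fun_prop) (by fun_prop)]
  simp only [inner_smul_right, norm_smul, hu] at h
  rw [Real.coe_toNNReal _ (sq_nonneg σ)]
  push_cast at h
  rw [h, mul_one, Real.norm_eq_abs, ← Complex.ofReal_pow |t|, sq_abs, Complex.ofReal_pow,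
    Complex.ofReal_pow]

/-- The upper level set of the privacy loss is a half-space. -/
lemma setOf_gpdf_sub_nonneg {d : ℕ} {σ : ℝ} (hσ : 0 < σ) (ε : ℝ)
    {a b : EuclideanSpace ℝ (Fin d)} (hab : a ≠ b) :
    {y | 0 ≤ gpdf d σ a y - Real.exp ε * gpdf d σ b y} =
      (fun y => inner ℝ y (‖a - b‖⁻¹ • (a - b))) ⁻¹'
        Set.Ici ((2 * σ ^ 2 * ε + ‖a‖ ^ 2 - ‖b‖ ^ 2) / (2 * ‖a - b‖)) := by
  have hr : 0 < ‖a - b‖ := norm_sub_pos_iff.2 hab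
  ext y
  have hK : 0 < (2 * Real.pi * σ ^ 2) ^ (-(d : ℝ) / 2) := by positivity
  have h1 : gpdf d σ a y - Real.exp ε * gpdf d σ b y = (2 * Real.pi * σ ^ 2) ^ (-(d : ℝ) / 2) *
      (Real.exp (-‖y - a‖ ^ 2 / (2 * σ ^ 2)) - Real.exp (ε + -‖y - b‖ ^ 2 / (2 * σ ^ 2))) := by
    rw [gpdf, gpdf, Real.exp_add]
    ring
  have h2 : ε + -‖y - b‖ ^ 2 / (2 * σ ^ 2) = (2 * σ ^ 2 * ε - ‖y - b‖ ^ 2) / (2 * σ ^ 2) := by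
    field_simp
    ring
  rw [Set.mem_ofPred_eq, h1, mul_nonneg_iff_of_pos_left hK, sub_nonneg, Real.exp_le_exp, h2,
    div_le_div_iff_of_pos_right (by positivity), norm_sub_sq_real, norm_sub_sq_real,
    Set.mem_preimage, Set.mem_Ici, inner_smul_right, inner_sub_right, div_le_iff₀ (by positivity),
    show ‖a - b‖⁻¹ * (inner ℝ y a - inner ℝ y b) * (2 * ‖a - b‖)
      = 2 * (inner ℝ y a - inner ℝ y b) by field_simp]
  constructor <;> intro h <;> linarith

lemma setIntegral_gpdf_halfspace {d : ℕ} {σ : ℝ} (hσ : 0 < σ) (a : EuclideanSpace ℝ (Fin d))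
    {u : EuclideanSpace ℝ (Fin d)} (hu : ‖u‖ = 1) (c : ℝ) :
    ∫ y in (fun y => inner ℝ y u) ⁻¹' Set.Ici c, gpdf d σ a y = Phi ((inner ℝ a u - c) / σ) := by
  have hm : Measurable fun y : EuclideanSpace ℝ (Fin d) => inner ℝ y u := by fun_prop
  rw [← gaussianReal_Ici_eq_Phi _ _ hσ, ← map_inner_withDensity_gpdf hσ a hu,
    map_measureReal_apply hm measurableSet_Ici, measureReal_def,
    toReal_withDensity_gpdf σ a (hm measurableSet_Ici)]

/-- The hockey-stick divergence between two isotropic Gaussians. -/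
lemma setIntegral_gpdf_sub {d : ℕ} {σ : ℝ} (hσ : 0 < σ) (ε : ℝ)
    {a b : EuclideanSpace ℝ (Fin d)} (hab : a ≠ b) :
    ∫ y in {y | 0 ≤ gpdf d σ a y - Real.exp ε * gpdf d σ b y},
        (gpdf d σ a y - Real.exp ε * gpdf d σ b y) =
      Phi (‖a - b‖ / σ / 2 - ε / (‖a - b‖ / σ)) -
        Real.exp ε * Phi (-(‖a - b‖ / σ / 2) - ε / (‖a - b‖ / σ)) := by
  have hr : 0 < ‖a - b‖ := norm_sub_pos_iff.2 hab
  have hu : ‖‖a - b‖⁻¹ • (a - b)‖ = 1 := by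
    rw [norm_smul, norm_inv, norm_norm, inv_mul_cancel₀ hr.ne']
  have hsq := norm_sub_sq_real a b
  rw [integral_sub (integrable_gpdf hσ a).integrableOn
    ((integrable_gpdf hσ b).const_mul _).integrableOn, integral_const_mul,
    setOf_gpdf_sub_nonneg hσ ε hab, setIntegral_gpdf_halfspace hσ a hu,
    setIntegral_gpdf_halfspace hσ b hu]
  congr 3
  · rw [inner_smul_right, inner_sub_right, real_inner_self_eq_norm_sq]
    field_simp
    linarith
  · rw [inner_smul_right, inner_sub_right, real_inner_self_eq_norm_sq, real_inner_comm]
    field_simp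
    linarith

theorem analytic_gaussian_mechanism {𝕏 : Type*} {d : ℕ}
    (rel : 𝕏 → 𝕏 → Prop) (f : 𝕏 → EuclideanSpace ℝ (Fin d))
    (Δ : ℝ) (hΔpos : 0 < Δ) (hΔ : ∀ x x', rel x x' → ‖f x - f x'‖ ≤ Δ)
    (hatt : ∃ x x', rel x x' ∧ ‖f x - f x'‖ = Δ)
    (ε δ σ : ℝ) (hε : 0 ≤ ε) (hδ0 : 0 ≤ δ) (hδ1 : δ ≤ 1) (hσ : 0 < σ) :
    (∀ x x', rel x x' → ∀ E : Set (EuclideanSpace ℝ (Fin d)), MeasurableSet E →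
        ((volume.withDensity fun y => ENNReal.ofReal (gpdf d σ (f x) y)) E).toReal ≤
          Real.exp ε *
              ((volume.withDensity fun y => ENNReal.ofReal (gpdf d σ (f x') y)) E).toReal +
            δ) ↔
      Phi (Δ / (2 * σ) - ε * σ / Δ) -
          Real.exp ε * Phi (-(Δ / (2 * σ)) - ε * σ / Δ) ≤ δ := by
  have hεe : 1 ≤ Real.exp ε := Real.one_le_exp hε
  have hrw : Phi (Δ / (2 * σ) - ε * σ / Δ) - Real.exp ε * Phi (-(Δ / (2 * σ)) - ε * σ / Δ) =
      Phi (Δ / σ / 2 - ε / (Δ / σ)) - Real.exp ε * Phi (-(Δ / σ / 2) - ε / (Δ / σ)) := by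
    rw [div_div_eq_mul_div, div_div, mul_comm σ 2]
  have hint : ∀ a b : EuclideanSpace ℝ (Fin d),
      Integrable fun y => gpdf d σ a y - Real.exp ε * gpdf d σ b y := fun a b =>
    (integrable_gpdf hσ a).sub ((integrable_gpdf hσ b).const_mul _)
  have hsm : ∀ a b : EuclideanSpace ℝ (Fin d),
      Continuous fun y => gpdf d σ a y - Real.exp ε * gpdf d σ b y := fun a b =>
    (continuous_gpdf d σ a).sub ((continuous_gpdf d σ b).const_mul _)
  have hset : ∀ (a b : EuclideanSpace ℝ (Fin d)) (E : Set (EuclideanSpace ℝ (Fin d))),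
      ∫ y in E, (gpdf d σ a y - Real.exp ε * gpdf d σ b y) =
        (∫ y in E, gpdf d σ a y) - Real.exp ε * ∫ y in E, gpdf d σ b y := fun a b E => by
    rw [integral_sub (integrable_gpdf hσ a).integrableOn
      ((integrable_gpdf hσ b).const_mul _).integrableOn, integral_const_mul]
  rw [hrw]
  constructor
  · intro h
    obtain ⟨x, x', hx, hn⟩ := hatt
    have hab : f x ≠ f x' := norm_sub_pos_iff.1 (hn ▸ hΔpos)
    have hE : MeasurableSet {y | 0 ≤ gpdf d σ (f x) y - Real.exp ε * gpdf d σ (f x') y} :=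
      measurableSet_le measurable_const (hsm _ _).measurable
    have := h x x' hx _ hE
    rw [toReal_withDensity_gpdf σ _ hE, toReal_withDensity_gpdf σ _ hE] at this
    rw [← hn, ← setIntegral_gpdf_sub hσ ε hab, hset]
    linarith
  · intro h x x' hx E hE
    rw [toReal_withDensity_gpdf σ _ hE, toReal_withDensity_gpdf σ _ hE]
    by_cases hab : f x = f x'
    · rw [hab]
      have := setIntegral_nonneg (μ := volume) hE fun y _ => gpdf_nonneg d σ (f x') y
      nlinarith
    · have hr : 0 < ‖f x - f x'‖ := norm_sub_pos_iff.2 hab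
      have h1 := setIntegral_le_nonneg hE (hsm (f x) (f x')).stronglyMeasurable (hint _ _)
      rw [setIntegral_gpdf_sub hσ ε hab, hset] at h1
      have h2 := monotoneOn_Phi_sub ε (div_pos hr hσ) (div_pos hΔpos hσ)
        (div_le_div_of_nonneg_right (hΔ x x' hx) hσ.le)
      simp only at h2
      linarith
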